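/- arXiv:2507.19294 — 8 statements merged into one kernel-verified Lean document; each statement's English description precedes it below -/
import Mathlib

section
/- Let N ≥ 2 be a natural number, let S be a finite set with |S| = N, let p : S → ℝ satisfy p(i) > 0 for all i ∈ S, and let Z be a real number with p(i) ≤ Z for all i ∈ S. Then Z < Σ_{i ∈ S} p(i) / (1 - (1 - p(i)/Z)^N). (Hence when the sample has all counts equal to 1, the iteration Z := φ(Z) satisfies Z < φ(Z) for every admissible Z and diverges to infinity.) -/
/-- A strict Bernoulli inequality, written for `1 - (1 - x) ^ n`. -/
theorem one_sub_one_sub_pow_lt_mul {n : ℕ} (hn : 2 ≤ n) {x : ℝ} (hx : 0 < x) (hx1 : x ≤ 1) :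
    1 - (1 - x) ^ n < n * x := by
  induction n, hn using Nat.le_induction with
  | base => push_cast; nlinarith
  | succ n hn ih =>
    have hpow : (1 - x) ^ n < 1 := pow_lt_one₀ (by linarith) (by linarith) (by omega)
    rw [pow_succ]
    push_cast
    nlinarith

/-- Let `N ≥ 2`, let `S` be a finite set with `|S| = N`, let `p : S → ℝ` be
positive on `S`, and let `Z` satisfy `p i ≤ Z` on `S`. Then
`Z < ∑ i ∈ S, p i / (1 - (1 - p i / Z)^N)`. -/
theorem stmt_1 {ι : Type*} (N : ℕ) (hN : 2 ≤ N) (S : Finset ι) (hS : S.card = N)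
    (p : ι → ℝ) (hp : ∀ i ∈ S, 0 < p i) (Z : ℝ) (hZ : ∀ i ∈ S, p i ≤ Z) :
    Z < ∑ i ∈ S, p i / (1 - (1 - p i / Z) ^ N) := by
  have hne : S.Nonempty := Finset.card_pos.mp (by omega)
  have hZ0 : 0 < Z := by
    obtain ⟨i, hi⟩ := hne
    exact (hp i hi).trans_le (hZ i hi)
  have hN0 : (0 : ℝ) < N := by exact_mod_cast (by omega : 0 < N)
  calc
    Z = ∑ _i ∈ S, Z / N := by
      rw [Finset.sum_const, hS, nsmul_eq_mul, mul_div_cancel₀ _ hN0.ne']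
    _ < ∑ i ∈ S, p i / (1 - (1 - p i / Z) ^ N) := by
      refine Finset.sum_lt_sum_of_nonempty hne fun i hi => ?_
      have hx : 0 < p i / Z := div_pos (hp i hi) hZ0
      have hx1 : p i / Z ≤ 1 := (div_le_one hZ0).mpr (hZ i hi)
      have hpow : (1 - p i / Z) ^ N < 1 := pow_lt_one₀ (by linarith) (by linarith) (by omega)
      rw [div_lt_div_iff₀ hN0 (by linarith)]
      calc
        Z * (1 - (1 - p i / Z) ^ N) < Z * (N * (p i / Z)) :=
          mul_lt_mul_of_pos_left (one_sub_one_sub_pow_lt_mul hN hx hx1) hZ0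
        _ = p i * N := by field_simp
end

section
/- Let N ≥ 2 be a natural number. Then for all real t with 0 < t < N, (1 - t/N)^N > (2 - t - t/N) / (2 + t - t/N). -/
/-- The inequality of `stmt_6` with denominators cleared, in the variable `x = t / N`. -/
theorem two_sub_lt_mul_one_sub_pow {x : ℝ} (hx : 0 < x) (hx1 : x < 1) {n : ℕ} (hn : 2 ≤ n) :
    2 - (n + 1) * x < (2 + (n - 1) * x) * (1 - x) ^ n := by
  induction n, hn using Nat.le_induction with
  | base =>
    have hx3 : 0 < x ^ 3 := by positivity
    push_cast
    linarith
  | succ n hn ih =>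
    have hn' : (2 : ℝ) ≤ n := by exact_mod_cast hn
    have hden : 0 < 2 + ((n : ℝ) - 1) * x := by nlinarith
    have hfac : 0 < (2 + (n : ℝ) * x) * (1 - x) :=
      mul_pos (by positivity) (sub_pos.mpr hx1)
    have hmul := mul_lt_mul_of_pos_left ih hfac
    have hpos : 0 < (n : ℝ) * (n + 1) * x ^ 3 := by positivity
    rw [pow_succ]
    push_cast
    refine lt_of_mul_lt_mul_left ?_ hden.le
    linear_combination hmul + hpos

/-- For `N ≥ 2` and `0 < t < N`,
`(1 - t/N)^N > (2 - t - t/N) / (2 + t - t/N)`. -/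
theorem stmt_6 (N : ℕ) (hN : 2 ≤ N) (t : ℝ) (ht : 0 < t) (htN : t < N) :
    (2 - t - t / N) / (2 + t - t / N) < (1 - t / N) ^ N := by
  have hN0 : (0 : ℝ) < N := ht.trans htN
  have hx1 : t / N < 1 := (div_lt_one hN0).mpr htN
  have hNx : (N : ℝ) * (t / N) = t := mul_div_cancel₀ t hN0.ne'
  have key := two_sub_lt_mul_one_sub_pow (div_pos ht hN0) hx1 hN
  rw [add_mul, sub_mul, hNx, one_mul, ← sub_sub, ← add_sub_assoc] at key
  rw [div_lt_iff₀ (by linarith)]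
  linarith
end

section
/- Let N ≥ 2 be a natural number. Then for all real t with 0 < t < N, -(1 - t/N)^{N-1} + (1 + (1 - 1/N)·t/2)^{-2} > 0. -/
theorem one_sub_pow_mul_sq_lt_one {x : ℝ} (hx : 0 < x) (hx1 : x < 1) (n : ℕ) :
    (1 - x) ^ (n + 1) * (1 + ((n + 1 : ℕ) : ℝ) * x / 2) ^ 2 < 1 := by
  have step (m : ℕ) :
      (1 - x) * (1 + ((m + 1 : ℕ) : ℝ) * x / 2) ^ 2 < (1 + (m : ℝ) * x / 2) ^ 2 := by
    have hu : 0 ≤ (m : ℝ) * x / 2 := by positivity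
    have h1 : (1 + ((m + 1 : ℕ) : ℝ) * x / 2) = 1 + (m : ℝ) * x / 2 + x / 2 := by
      push_cast
      ring
    rw [h1]
    generalize (m : ℝ) * x / 2 = u at hu
    nlinarith [mul_nonneg (mul_nonneg hu hx.le) (by linarith : 0 ≤ 1 + u),
      mul_nonneg hu (sq_nonneg x), pow_pos hx 2, pow_pos hx 3]
  induction n with
  | zero => simpa using step 0
  | succ k ih =>
    refine lt_trans ?_ ih
    rw [pow_succ (1 - x) (k + 1), mul_assoc]
    exact mul_lt_mul_of_pos_left (step (k + 1)) (pow_pos (by linarith) _)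

/-- For `N ≥ 2` and `0 < t < N`,
`-(1 - t/N)^(N-1) + (1 + (1 - 1/N) * t/2)⁻² > 0`. -/
theorem stmt_8 (N : ℕ) (hN : 2 ≤ N) (t : ℝ) (ht : 0 < t) (htN : t < N) :
    0 < -(1 - t / N) ^ (N - 1) + ((1 + (1 - 1 / (N : ℝ)) * t / 2) ^ 2)⁻¹ := by
  have hN0 : (0 : ℝ) < N := ht.trans htN
  obtain ⟨n, rfl⟩ := Nat.exists_eq_add_of_le' hN
  have h := one_sub_pow_mul_sq_lt_one (div_pos ht hN0) ((div_lt_one hN0).2 htN) n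
  have he : (1 - 1 / ((n + 2 : ℕ) : ℝ)) * t / 2
      = ((n + 1 : ℕ) : ℝ) * (t / ((n + 2 : ℕ) : ℝ)) / 2 := by
    field_simp
    push_cast
    ring
  rw [he, show n + 2 - 1 = n + 1 from rfl, neg_add_eq_sub, sub_pos, ← one_div,
    lt_div_iff₀ (by positivity)]
  exact h
end

section
/- Let N ≥ 2 be a natural number and define ψ : (0, N) → ℝ by ψ(t) = 1 / (1 - (1 - t/N)^N). Then for all 0 < t < N, t²·(d/dt)(t²·ψ'(t)) > 0, where ψ' denotes the derivative of ψ. -/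
/-- The tangent-line inequality for `x ↦ x ^ (n + 1)`, homogenised. -/
theorem succ_mul_pow_le_one_add_mul_pow_succ {x : ℝ} (hx : 0 ≤ x) (hx1 : x ≤ 1) (n : ℕ) :
    ((n : ℝ) + 1) * x ^ n ≤ 1 + n * x ^ (n + 1) := by
  induction n with
  | zero => simp
  | succ n ih =>
    have h1 : x ^ (n + 1) ≤ 1 := pow_le_one₀ hx hx1
    have h2 := mul_nonneg (sub_nonneg.2 hx1) (sub_nonneg.2 h1)
    have h3 := mul_le_mul_of_nonneg_left ih hx
    push_cast
    ring_nf at h2 h3 ⊢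
    linarith

/-- The closed form of `2 * ∑ i ∈ Finset.Icc 1 (n + 2), x ^ i < (n + 1) + (n + 3) * x ^ (n + 2)`,
multiplied through by `1 - x`. -/
theorem two_mul_sub_pow_lt {x : ℝ} (hx : 0 ≤ x) (hx1 : x < 1) (n : ℕ) :
    2 * x * (1 - x ^ (n + 2)) <
      ((n : ℝ) + 1) * (1 - x) * (1 - x ^ (n + 2)) + 2 * (n + 2) * (1 - x) * x ^ (n + 2) := by
  induction n with
  | zero =>
    have h := pow_pos (sub_pos.2 hx1) 3
    simp only [Nat.cast_zero, zero_add]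
    nlinarith
  | succ n ih =>
    have h := mul_le_mul_of_nonneg_left
      (succ_mul_pow_le_one_add_mul_pow_succ hx hx1.le (n + 2)) (sub_nonneg.2 hx1.le)
    push_cast at h ⊢
    ring_nf at h ih ⊢
    linarith

/-- For `N ≥ 2` and `ψ(t) = 1 / (1 - (1 - t/N)^N)`, for all `0 < t < N`,
`t^2 * (d/dt)(t^2 * ψ'(t)) > 0`. -/
theorem stmt_9 (N : ℕ) (hN : 2 ≤ N) (t : ℝ) (ht : 0 < t) (htN : t < N) :
    0 < t ^ 2 *
      deriv (fun s : ℝ => s ^ 2 * deriv (fun u : ℝ => 1 / (1 - (1 - u / N) ^ N)) s) t := by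
  obtain ⟨n, rfl⟩ := Nat.exists_eq_add_of_le' hN
  set M : ℝ := ((n + 2 : ℕ) : ℝ) with hM
  have hMn : M = n + 2 := by rw [hM]; push_cast; ring
  have hM0 : 0 < M := ht.trans htN
  have base (s : ℝ) : HasDerivAt (fun u : ℝ => 1 - u / M) (-(1 / M)) s :=
    ((hasDerivAt_id s).div_const M).const_sub 1
  have bounds {s : ℝ} (hs : s ∈ Set.Ioo 0 M) : 0 < 1 - s / M ∧ 1 - s / M < 1 :=
    ⟨sub_pos.2 ((div_lt_one hM0).2 hs.2), sub_lt_self _ (div_pos hs.1 hM0)⟩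
  have denom_pos {s : ℝ} (hs : s ∈ Set.Ioo 0 M) : 0 < 1 - (1 - s / M) ^ (n + 2) :=
    sub_pos.2 (pow_lt_one₀ (bounds hs).1.le (bounds hs).2 (by omega))
  have denom_deriv (s : ℝ) : HasDerivAt (fun u : ℝ => 1 - (1 - u / M) ^ (n + 2))
      ((1 - s / M) ^ (n + 1)) s := by
    refine (((base s).pow (n + 2)).const_sub 1).congr_deriv ?_
    rw [← hM, show n + 2 - 1 = n + 1 by omega]
    field_simp
  have first {s : ℝ} (hs : s ∈ Set.Ioo 0 M) :
      deriv (fun u : ℝ => 1 / (1 - (1 - u / M) ^ (n + 2))) s =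
        -(1 - s / M) ^ (n + 1) / (1 - (1 - s / M) ^ (n + 2)) ^ 2 := by
    simp only [one_div]
    exact ((denom_deriv s).inv (denom_pos hs).ne').deriv
  have htm : t ∈ Set.Ioo 0 M := ⟨ht, htN⟩
  have ev : (fun s : ℝ => s ^ 2 * deriv (fun u : ℝ => 1 / (1 - (1 - u / M) ^ (n + 2))) s)
      =ᶠ[nhds t] fun s => s ^ 2 *
        (-(1 - s / M) ^ (n + 1) / (1 - (1 - s / M) ^ (n + 2)) ^ 2) := by
    filter_upwards [isOpen_Ioo.mem_nhds htm] with s hs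
    rw [first hs]
  have second := ((hasDerivAt_id t).pow 2).mul ((((base t).pow (n + 1)).neg).div
    ((denom_deriv t).pow 2) (pow_pos (denom_pos htm) 2).ne')
  have key := two_mul_sub_pow_lt (bounds htm).1.le (bounds htm).2 n
  have hD := denom_pos htm
  have hx := (bounds htm).1
  rw [ev.deriv_eq]
  refine mul_pos (pow_pos ht 2) ?_
  refine (?_ : (0 : ℝ) < _).trans_eq second.deriv.symm
  have htx : t = M * (1 - (1 - t / M)) := by field_simp; ring
  simp only [id, Pi.pow_apply, Pi.neg_apply, Pi.div_apply]
  generalize 1 - t / M = x at *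
  have hx1 : 0 < 1 - x := pos_of_mul_pos_right (htx ▸ ht) hM0.le
  have hpos : 0 < t * x ^ n / (1 - x ^ (n + 2)) ^ 3 *
      ((n + 1) * (1 - x) * (1 - x ^ (n + 2)) + 2 * (n + 2) * (1 - x) * x ^ (n + 2)
        - 2 * x * (1 - x ^ (n + 2))) :=
    mul_pos (by positivity) (sub_pos.2 key)
  refine hpos.trans_eq ?_
  have hD' := hD.ne'
  have hn : (n : ℝ) = M - 2 := by linarith
  have hM' := hM0.ne'
  simp only [Nat.add_sub_cancel, Nat.cast_add, Nat.cast_one, Nat.cast_ofNat, hn]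
  rw [htx]
  field_simp
  ring
end

section
/- Let N ≥ 2 be a natural number and let p > 0 be a real number. Then the function Z ↦ p / (1 - (1 - p/Z)^N) is strictly monotone increasing on the interval (p, ∞). -/
/-- For `N ≥ 2` and `p > 0`, the map `Z ↦ p / (1 - (1 - p/Z)^N)` is
strictly monotone increasing on `(p, ∞)`. -/
theorem stmt_10 (N : ℕ) (hN : 2 ≤ N) (p : ℝ) (hp : 0 < p) :
    StrictMonoOn (fun Z : ℝ => p / (1 - (1 - p / Z) ^ N)) (Set.Ioi p) := by
  intro a ha b hb hab
  have ha0 : 0 < a := hp.trans ha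
  have hb0 : 0 < b := hp.trans hb
  have hN0 : N ≠ 0 := by omega
  have ha1 : p / a < 1 := (div_lt_one ha0).2 ha
  have hb1 : p / b < 1 := (div_lt_one hb0).2 hb
  have hpb : 0 < p / b := div_pos hp hb0
  have hlt : p / b < p / a := div_lt_div_of_pos_left hp ha0 hab
  have hpow : (1 - p / a) ^ N < (1 - p / b) ^ N :=
    pow_lt_pow_left₀ (by linarith) (by linarith) hN0
  have hone : (1 - p / b) ^ N < 1 := pow_lt_one₀ (by linarith) (by linarith) hN0
  exact div_lt_div_of_pos_left hp (by linarith) (by linarith)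
end

section
/- Let N ≥ 2 be a natural number and let p > 0 be a real number. Then the function Z ↦ p / (1 - (1 - p/Z)^N) is strictly convex on the interval (p, ∞). -/
lemma one_sub_mul_pow_add_mul_pow_pos {q : ℝ} (hq0 : 0 < q) (hq1 : q < 1) (n : ℕ) :
    0 < 1 - (n + 2) * q ^ (n + 1) + (n + 1) * q ^ (n + 2) := by
  have hq : 0 < 1 - q := sub_pos.2 hq1
  induction n with
  | zero =>
    have : 0 < (1 - q) ^ 2 := by positivity
    norm_num
    linarith
  | succ n ih =>
    have : 0 < ((n : ℝ) + 2) * q ^ (n + 1) * (1 - q) ^ 2 := by positivity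
    push_cast
    linear_combination ih + this

lemma sub_mul_add_mul_pow_sub_mul_pow_pos {q : ℝ} (hq0 : 0 < q) (hq1 : q < 1) (n : ℕ) :
    0 < (n + 1) - (n + 3) * q + (n + 3) * q ^ (n + 2) - (n + 1) * q ^ (n + 3) := by
  have hq : 0 < 1 - q := sub_pos.2 hq1
  induction n with
  | zero =>
    have : 0 < (1 - q) ^ 3 := by positivity
    norm_num
    linarith
  | succ n ih =>
    have := mul_pos hq (one_sub_mul_pow_add_mul_pow_pos hq0 hq1 (n + 1))
    push_cast at this ⊢
    linear_combination ih + this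

lemma strictMonoOn_pow_mul_sq_div_sq (n : ℕ) :
    StrictMonoOn (fun q : ℝ => q ^ (n + 1) * (1 - q) ^ 2 / (1 - q ^ (n + 2)) ^ 2)
      (Set.Ioo 0 1) := by
  have hD {q : ℝ} (hq : q ∈ Set.Ioo (0 : ℝ) 1) : 0 < 1 - q ^ (n + 2) :=
    sub_pos.2 (pow_lt_one₀ hq.1.le hq.2 (by simp))
  have hderiv {q : ℝ} (hq : q ∈ Set.Ioo (0 : ℝ) 1) :
      HasDerivAt (fun q : ℝ => q ^ (n + 1) * (1 - q) ^ 2 / (1 - q ^ (n + 2)) ^ 2)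
        (q ^ n * (1 - q) *
          ((n + 1) - (n + 3) * q + (n + 3) * q ^ (n + 2) - (n + 1) * q ^ (n + 3)) /
            (1 - q ^ (n + 2)) ^ 3) q := by
    have hne := (hD hq).ne'
    refine (((hasDerivAt_pow (n + 1) q).mul (((hasDerivAt_id q).const_sub 1).pow 2)).div
      (((hasDerivAt_pow (n + 2) q).const_sub 1).pow 2) (pow_ne_zero 2 hne)).congr_deriv ?_
    simp only [Pi.pow_apply, Pi.mul_apply, id_eq]
    rw [div_eq_div_iff (pow_ne_zero _ (pow_ne_zero _ hne)) (pow_ne_zero _ hne)]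
    push_cast
    ring
  refine strictMonoOn_of_deriv_pos (convex_Ioo 0 1)
    (fun q hq => (hderiv hq).continuousAt.continuousWithinAt) fun q hq => ?_
  rw [interior_Ioo] at hq
  rw [(hderiv hq).deriv]
  have := sub_mul_add_mul_pow_sub_mul_pow_pos hq.1 hq.2 n
  have := hD hq
  have := sub_pos.2 hq.2
  have := hq.1
  positivity

/-- For `N ≥ 2` and `p > 0`, the map `Z ↦ p / (1 - (1 - p/Z)^N)` is
strictly convex on `(p, ∞)`. -/
theorem stmt_11 (N : ℕ) (hN : 2 ≤ N) (p : ℝ) (hp : 0 < p) :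
    StrictConvexOn ℝ (Set.Ioi p) (fun Z : ℝ => p / (1 - (1 - p / Z) ^ N)) := by
  obtain ⟨n, rfl⟩ := Nat.exists_eq_add_of_le' hN
  have hmem {Z : ℝ} (hZ : Z ∈ Set.Ioi p) : 1 - p / Z ∈ Set.Ioo (0 : ℝ) 1 :=
    ⟨sub_pos.2 ((div_lt_one (hp.trans hZ)).2 hZ), sub_lt_self _ (div_pos hp (hp.trans hZ))⟩
  have hderiv {Z : ℝ} (hZ : Z ∈ Set.Ioi p) :
      HasDerivAt (fun Z : ℝ => p / (1 - (1 - p / Z) ^ (n + 2)))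
        ((n + 2) * ((1 - p / Z) ^ (n + 1) * (1 - (1 - p / Z)) ^ 2 /
          (1 - (1 - p / Z) ^ (n + 2)) ^ 2)) Z := by
    have hZ0 : Z ≠ 0 := (hp.trans hZ).ne'
    have hne : 1 - (1 - p / Z) ^ (n + 2) ≠ 0 :=
      (sub_pos.2 (pow_lt_one₀ (hmem hZ).1.le (hmem hZ).2 (by simp))).ne'
    have hq : HasDerivAt (fun Z : ℝ => 1 - p / Z) (p / Z ^ 2) Z := by
      refine (((hasDerivAt_const Z p).div (hasDerivAt_id Z) hZ0).const_sub 1).congr_deriv ?_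
      simp [neg_div]
    refine ((hasDerivAt_const Z p).div ((hq.pow (n + 2)).const_sub 1) hne).congr_deriv ?_
    simp only [Pi.pow_apply, show n + 2 - 1 = n + 1 from rfl]
    rw [mul_div_assoc', sub_sub_cancel]
    push_cast
    field_simp
    ring
  refine StrictMonoOn.strictConvexOn_of_deriv (convex_Ioi p)
    (fun Z hZ => (hderiv hZ).continuousAt.continuousWithinAt) ?_
  rw [interior_Ioi]
  intro x hx y hy hxy
  rw [(hderiv hx).deriv, (hderiv hy).deriv]
  have hlt : 1 - p / x < 1 - p / y :=
    sub_lt_sub_left (div_lt_div_of_pos_left hp (hp.trans hx) hxy) 1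
  exact mul_lt_mul_of_pos_left
    (strictMonoOn_pow_mul_sq_div_sq n (hmem hx) (hmem hy) hlt) (by positivity)
end

section
/- Let S be a finite set with 2 ≤ |S|, let N be a natural number with |S| < N, and let p : S → ℝ satisfy p(i) > 0 for all i ∈ S. Set P(S) = Σ_{i ∈ S} p(i). Then there exists a unique real number Z ≥ P(S) such that Z = Σ_{i ∈ S} p(i) / (1 - (1 - p(i)/Z)^N). -/
theorem one_le_geom_sum {N : ℕ} (hN : 0 < N) {u : ℝ} (hu : 0 ≤ u) :
    1 ≤ ∑ k ∈ Finset.range N, u ^ k := by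
  simpa using Finset.single_le_sum (f := fun k => u ^ k) (fun k _ => pow_nonneg hu k)
    (Finset.mem_range.2 hN)

theorem geom_sum_strictMonoOn {N : ℕ} (hN : 1 < N) :
    StrictMonoOn (fun u : ℝ => ∑ k ∈ Finset.range N, u ^ k) (Set.Ici 0) := by
  intro u hu v _ huv
  exact Finset.sum_lt_sum (fun k _ => pow_le_pow_left₀ hu huv.le k)
    ⟨1, Finset.mem_range.2 hN, by simpa using huv⟩

/-- With `Z = 1 / y`, the fixed point equation says that this sum equals `1`. -/
noncomputable def invGeomSum {ι : Type*} (S : Finset ι) (N : ℕ) (p : ι → ℝ) (y : ℝ) : ℝ :=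
  ∑ i ∈ S, (∑ k ∈ Finset.range N, (1 - p i * y) ^ k)⁻¹

section

variable {ι : Type*} {S : Finset ι} {N : ℕ} {p : ι → ℝ}

theorem one_sub_mul_nonneg (hp : ∀ i ∈ S, 0 < p i) {y : ℝ}
    (hy : y ∈ Set.Icc 0 (∑ i ∈ S, p i)⁻¹) {i : ι} (hi : i ∈ S) : 0 ≤ 1 - p i * y := by
  have hle : p i ≤ ∑ i ∈ S, p i := Finset.single_le_sum (fun j hj => (hp j hj).le) hi
  have hP : 0 < ∑ i ∈ S, p i := (hp i hi).trans_le hle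
  have h := mul_le_mul hle hy.2 hy.1 hP.le
  rw [mul_inv_cancel₀ hP.ne'] at h
  linarith

theorem invGeomSum_continuousOn (hN : 0 < N) (hp : ∀ i ∈ S, 0 < p i) :
    ContinuousOn (invGeomSum S N p) (Set.Icc 0 (∑ i ∈ S, p i)⁻¹) := by
  refine continuousOn_finsetSum S fun i hi => ContinuousOn.inv₀ (by fun_prop) fun y hy => ?_
  exact (zero_lt_one.trans_le (one_le_geom_sum hN (one_sub_mul_nonneg hp hy hi))).ne'

theorem invGeomSum_strictMonoOn (hS : S.Nonempty) (hN : 1 < N) (hp : ∀ i ∈ S, 0 < p i) :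
    StrictMonoOn (invGeomSum S N p) (Set.Icc 0 (∑ i ∈ S, p i)⁻¹) := by
  intro y hy z hz hyz
  refine Finset.sum_lt_sum_of_nonempty hS fun i hi => ?_
  have hz' := one_sub_mul_nonneg hp hz hi
  have hlt : 1 - p i * z < 1 - p i * y := by
    have := mul_lt_mul_of_pos_left hyz (hp i hi)
    linarith
  exact inv_strictAnti₀ (zero_lt_one.trans_le (one_le_geom_sum (by omega) hz'))
    (geom_sum_strictMonoOn hN hz' (one_sub_mul_nonneg hp hy hi) hlt)

theorem invGeomSum_zero : invGeomSum S N p 0 = S.card / N := by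
  simp [invGeomSum, div_eq_mul_inv]

theorem sum_div_eq_mul_invGeomSum (hp : ∀ i ∈ S, 0 < p i) (Z : ℝ) :
    ∑ i ∈ S, p i / (1 - (1 - p i / Z) ^ N) = Z * invGeomSum S N p Z⁻¹ := by
  rw [invGeomSum, Finset.mul_sum]
  refine Finset.sum_congr rfl fun i hi => ?_
  have hpi := (hp i hi).ne'
  rw [← mul_neg_geom_sum, sub_sub_cancel, ← div_eq_mul_inv (p i) Z, div_mul_eq_div_div,
    div_div_cancel₀ hpi, div_eq_mul_inv]

theorem one_le_invGeomSum (hS : S.Nonempty) (hN : 0 < N) (hp : ∀ i ∈ S, 0 < p i) :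
    1 ≤ invGeomSum S N p (∑ i ∈ S, p i)⁻¹ := by
  have hP : 0 < ∑ i ∈ S, p i := Finset.sum_pos hp hS
  have hmem : (∑ i ∈ S, p i)⁻¹ ∈ Set.Icc 0 (∑ i ∈ S, p i)⁻¹ :=
    Set.right_mem_Icc.2 (inv_nonneg.2 hP.le)
  calc 1 = ∑ i ∈ S, p i * (∑ i ∈ S, p i)⁻¹ := by
        rw [← Finset.sum_mul, mul_inv_cancel₀ hP.ne']
    _ ≤ _ := Finset.sum_le_sum fun i hi => ?_
  have hu := one_sub_mul_nonneg hp hmem hi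
  refine le_of_le_of_eq ((le_div_iff₀ (zero_lt_one.trans_le (one_le_geom_sum hN hu))).2 ?_)
    (one_div _)
  have h := mul_neg_geom_sum (1 - p i * (∑ i ∈ S, p i)⁻¹) N
  rw [sub_sub_cancel] at h
  rw [h]
  linarith [pow_nonneg hu N]

end

/-- For a finite set `S` with `2 ≤ |S| < N` and `p` positive on `S`, with
`P(S) = ∑ i ∈ S, p i`, there exists a unique `Z ≥ P(S)` with
`Z = ∑ i ∈ S, p i / (1 - (1 - p i / Z)^N)`. -/
theorem stmt_13 {ι : Type*} (S : Finset ι) (hS : 2 ≤ S.card) (N : ℕ) (hN : S.card < N)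
    (p : ι → ℝ) (hp : ∀ i ∈ S, 0 < p i) :
    ∃! Z : ℝ, (∑ i ∈ S, p i) ≤ Z ∧ Z = ∑ i ∈ S, p i / (1 - (1 - p i / Z) ^ N) := by
  have hne : S.Nonempty := Finset.card_pos.1 (by omega)
  have hP : 0 < ∑ i ∈ S, p i := Finset.sum_pos hp hne
  have hiff : ∀ Z : ℝ, 0 < Z →
      (Z = ∑ i ∈ S, p i / (1 - (1 - p i / Z) ^ N) ↔ invGeomSum S N p Z⁻¹ = 1) := by
    intro Z hZ
    rw [sum_div_eq_mul_invGeomSum hp Z, eq_comm, mul_eq_left₀ hZ.ne']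
  have hzero : invGeomSum S N p 0 < 1 := by
    rw [invGeomSum_zero, div_lt_one (by exact_mod_cast (by omega : 0 < N))]
    exact_mod_cast hN
  obtain ⟨y, hy, hy1⟩ := intermediate_value_Icc (inv_nonneg.2 hP.le)
    (invGeomSum_continuousOn (N := N) (by omega) hp)
    ⟨hzero.le, one_le_invGeomSum hne (by omega) hp⟩
  have hy0 : 0 < y := hy.1.lt_of_ne fun h => hzero.ne (h ▸ hy1)
  refine ⟨y⁻¹, ⟨(le_inv_comm₀ hP hy0).2 hy.2, ?_⟩, ?_⟩
  · rwa [hiff _ (inv_pos.2 hy0), inv_inv]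
  · rintro Z ⟨hPZ, hZ⟩
    have hZ0 := hP.trans_le hPZ
    rw [hiff Z hZ0] at hZ
    have hmem : Z⁻¹ ∈ Set.Icc 0 (∑ i ∈ S, p i)⁻¹ :=
      ⟨inv_nonneg.2 hZ0.le, inv_anti₀ hP hPZ⟩
    rw [← (invGeomSum_strictMonoOn hne (by omega) hp).injOn hmem hy (hZ.trans hy1.symm), inv_inv]
end

section
/- Let N ≥ 1 be a natural number and let x be a real number with 0 < x < 1. Then N·x·(1 - x)^{N-1} ≤ 1 - (1 - x)^N, and consequently x²·(1 - x)^N / (1 - (1 - x)^N) ≤ x·(1 - x)/N. That is, with x = p(i)/Z, the per-point variance p(i)²Z⁻²·(1 - p(i)/Z)^N/(1 - (1 - p(i)/Z)^N) of the proposed weight estimator is at most the per-point variance N⁻¹·(p(i)/Z)·(1 - p(i)/Z) of the BLUE estimator. -/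
theorem succ_mul_mul_one_sub_pow_le {x : ℝ} (hx : 0 ≤ x) (hx1 : x ≤ 1) (n : ℕ) :
    ((n : ℝ) + 1) * x * (1 - x) ^ n ≤ 1 - (1 - x) ^ (n + 1) := by
  have hy : 0 ≤ 1 - x := sub_nonneg.2 hx1
  induction n with
  | zero => simp
  | succ n ih =>
    have h1 := mul_le_mul_of_nonneg_left ih hy
    have h2 := mul_le_mul_of_nonneg_left
      (pow_le_one₀ hy (sub_le_self 1 hx) : (1 - x) ^ (n + 1) ≤ 1) hx
    push_cast
    calc ((n : ℝ) + 1 + 1) * x * (1 - x) ^ (n + 1)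
        = (1 - x) * ((n + 1) * x * (1 - x) ^ n) + x * (1 - x) ^ (n + 1) := by ring
      _ ≤ (1 - x) * (1 - (1 - x) ^ (n + 1)) + x * 1 := add_le_add h1 h2
      _ = 1 - (1 - x) ^ (n + 1 + 1) := by ring

/-- For `N ≥ 1` and `0 < x < 1`,
`N x (1 - x)^(N-1) ≤ 1 - (1 - x)^N`, and consequently
`x^2 (1 - x)^N / (1 - (1 - x)^N) ≤ x (1 - x) / N`: the per-point variance of the
proposed weight estimator is at most that of the BLUE estimator. -/
theorem stmt_19 (N : ℕ) (hN : 1 ≤ N) (x : ℝ) (hx : 0 < x) (hx1 : x < 1) :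
    (N : ℝ) * x * (1 - x) ^ (N - 1) ≤ 1 - (1 - x) ^ N ∧
    x ^ 2 * (1 - x) ^ N / (1 - (1 - x) ^ N) ≤ x * (1 - x) / N := by
  obtain ⟨n, rfl⟩ := Nat.exists_eq_add_of_le' hN
  have key := succ_mul_mul_one_sub_pow_le hx.le hx1.le n
  have hy : 0 < 1 - x := sub_pos.2 hx1
  have hq : 0 < 1 - (1 - x) ^ (n + 1) :=
    sub_pos.2 (pow_lt_one₀ hy.le (sub_lt_self 1 hx) n.succ_ne_zero)
  refine ⟨by simpa using key, ?_⟩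
  rw [div_le_div_iff₀ hq (by positivity)]
  push_cast
  calc x ^ 2 * (1 - x) ^ (n + 1) * ((n : ℝ) + 1)
      = x * (1 - x) * ((n + 1) * x * (1 - x) ^ n) := by ring
    _ ≤ x * (1 - x) * (1 - (1 - x) ^ (n + 1)) :=
      mul_le_mul_of_nonneg_left key (mul_pos hx hy).le
end
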